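/- For every m ∈ N, the k-algebra A^{⊗(m−1)} ⊗_k Ã is affine cellular with respect to the involution τ^{⊗m}, where τ acts on each tensor factor by fixing the vertex idempotents and swapping the two arrows. -/

import Mathlib

open scoped TensorProduct
open CategoryTheory

noncomputable section

namespace VVPaper

/-! ## The path algebra `A` of the quiver with two vertices and one arrow in each direction -/

/-- Generators of the path algebra: two vertex idempotents and two arrows. -/
inductive PGen : Type
  | e1 | e2 | u1 | u2
deriving DecidableEq

variable (k : Type) [Field k]

def gE1 : FreeAlgebra k PGen := FreeAlgebra.ι k PGen.e1
def gE2 : FreeAlgebra k PGen := FreeAlgebra.ι k PGen.e2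
def gU1 : FreeAlgebra k PGen := FreeAlgebra.ι k PGen.u1
def gU2 : FreeAlgebra k PGen := FreeAlgebra.ι k PGen.u2

/-- Relations presenting the path algebra of the quiver with two vertices `e₁, e₂` and arrows
`u₁ : e₁ → e₂`, `u₂ : e₂ → e₁`: the vertices are orthogonal idempotents summing to `1`, and
each arrow is supported at its source and target. -/
inductive PRel : FreeAlgebra k PGen → FreeAlgebra k PGen → Prop
  | e1_idem : PRel (gE1 k * gE1 k) (gE1 k)
  | e2_idem : PRel (gE2 k * gE2 k) (gE2 k)
  | orth12 : PRel (gE1 k * gE2 k) 0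
  | orth21 : PRel (gE2 k * gE1 k) 0
  | sum_eq_one : PRel (gE1 k + gE2 k) 1
  | u1_tgt : PRel (gE2 k * gU1 k) (gU1 k)
  | u1_src : PRel (gU1 k * gE1 k) (gU1 k)
  | u2_tgt : PRel (gE1 k * gU2 k) (gU2 k)
  | u2_src : PRel (gU2 k * gE2 k) (gU2 k)

/-- The path algebra `A` (equivalently `Ã`) of the quiver `e₁ ⇄ e₂`. -/
@[reducible] def PathA : Type := RingQuot (PRel k)

/-- The canonical projection onto the path algebra. -/
def pmk : FreeAlgebra k PGen →ₐ[k] PathA k := RingQuot.mkAlgHom k _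

/-- The vertex idempotent `e₁` (also denoted `a₁`). -/
def aE1 : PathA k := pmk k (gE1 k)
/-- The vertex idempotent `e₂` (also denoted `a₂`). -/
def aE2 : PathA k := pmk k (gE2 k)
/-- The arrow `u₁ : e₁ → e₂` (also denoted `v₁`). -/
def aU1 : PathA k := pmk k (gU1 k)
/-- The arrow `u₂ : e₂ → e₁` (also denoted `v₂`). -/
def aU2 : PathA k := pmk k (gU2 k)

/-- The `n`-th graded piece of the path algebra: the span of all products of generators
containing exactly `n` arrows (paths of length `n`). -/
def pathGrade (n : ℕ) : Submodule k (PathA k) :=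
  Submodule.span k
    {x : PathA k | ∃ l : List PGen,
      l.count PGen.u1 + l.count PGen.u2 = n ∧
      x = (l.map fun g => pmk k (FreeAlgebra.ι k g)).prod}

end VVPaper

namespace VVPaper

variable (k : Type) [Field k]

/-- Auxiliary construction of the iterated tensor power `A^{⊗ n}` together with its ring and
`k`-algebra structures. -/
def APowData (A : Type) [Ring A] [Algebra k A] : ℕ → Σ' (T : Type) (_ : Ring T), Algebra k T
  | 0 => ⟨k, inferInstance, inferInstance⟩
  | n + 1 =>
    let p := APowData A n
    letI := p.2.1
    letI := p.2.2
    ⟨p.1 ⊗[k] A, inferInstance, inferInstance⟩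

/-- The `n`-th tensor power `A^{⊗ n}` of a `k`-algebra (with `A^{⊗ 0} = k`). -/
def APow (A : Type) [Ring A] [Algebra k A] (n : ℕ) : Type := (APowData k A n).1

instance (A : Type) [Ring A] [Algebra k A] (n : ℕ) : Ring (APow k A n) :=
  (APowData k A n).2.1

instance (A : Type) [Ring A] [Algebra k A] (n : ℕ) : Algebra k (APow k A n) :=
  (APowData k A n).2.2

end VVPaper

namespace VVPaper

/-- The tensor power `τ^{⊗ n}` of a `k`-linear map `τ : A → A` on `A^{⊗ n}`. -/
def tauPow (k : Type) [Field k] (A : Type) [Ring A] [Algebra k A] (τ : A →ₗ[k] A) :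
    (n : ℕ) → APow k A n →ₗ[k] APow k A n
  | 0 => LinearMap.id
  | n + 1 =>
    show APow k A n ⊗[k] A →ₗ[k] APow k A n ⊗[k] A from
      TensorProduct.map (tauPow k A τ n) τ

end VVPaper

set_option synthInstance.maxHeartbeats 1000000
set_option maxHeartbeats 1600000

namespace VVPaper

/-! ## Affine cellularity (after Koenig–Xi) -/

/-- A `k`-involution of a `k`-algebra: a `k`-linear anti-automorphism of order two. -/
structure IsKInvolution {k A : Type} [Field k] [Ring A] [Algebra k A] (ω : A →ₗ[k] A) :
    Prop where
  map_mul : ∀ a b : A, ω (a * b) = ω b * ω a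
  map_one : ω 1 = 1
  involutive : ∀ a : A, ω (ω a) = a

/-- An affine cell ideal of `(H, ω)`: a two-sided ideal `J` with `ω(J) = J` such that for some
finite-rank free `k`-module `V = k^{nV}` and some affine commutative `k`-algebra `B`
(a quotient of a polynomial ring in finitely many variables) with involution `iB`, the
free module `Δ := V ⊗_k B ≅ (Fin nV → B)` carries a left `H`-action commuting with the
`B`-action (an `H`-`B`-bimodule), and there is an isomorphism `α : J ≅ Δ ⊗_B Δ'`
(`Δ' = B ⊗_k V ≅ Δ`) of `H`-`H`-bimodules, where the right `H`-action on `Δ'` is induced by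
the left action via `ω`, intertwining `ω` with the switch map
`v ⊗ b ⊗ b' ⊗ w ↦ w ⊗ iB(b') ⊗ iB(b) ⊗ v`. -/
def IsAffineCellIdeal (k : Type) [Field k] (H : Type) [Ring H] [Algebra k H]
    (ω : H →ₗ[k] H) (J : TwoSidedIdeal H) : Prop :=
  (∀ x : H, x ∈ J ↔ ω x ∈ J) ∧
  ∃ (nV N : ℕ) (Id : Ideal (MvPolynomial (Fin N) k))
    (iB : (MvPolynomial (Fin N) k ⧸ Id) ≃ₐ[k] (MvPolynomial (Fin N) k ⧸ Id)),
    (∀ b, iB (iB b) = b) ∧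
    ∃ (act : H →ₐ[k] Module.End (MvPolynomial (Fin N) k ⧸ Id)
        (Fin nV → MvPolynomial (Fin N) k ⧸ Id))
      (α : (Submodule.restrictScalars k
          (TwoSidedIdeal.asIdeal J : Ideal H)) ≃ₗ[k]
        TensorProduct (MvPolynomial (Fin N) k ⧸ Id)
          (Fin nV → MvPolynomial (Fin N) k ⧸ Id) (Fin nV → MvPolynomial (Fin N) k ⧸ Id)),
      (∀ (h : H) (x y : (Submodule.restrictScalars k (TwoSidedIdeal.asIdeal J : Ideal H))),
        (y : H) = h * (x : H) →
          α y = LinearMap.rTensor (Fin nV → MvPolynomial (Fin N) k ⧸ Id) (act h) (α x)) ∧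
      (∀ (h : H) (x y : (Submodule.restrictScalars k (TwoSidedIdeal.asIdeal J : Ideal H))),
        (y : H) = (x : H) * h →
          α y = LinearMap.lTensor (Fin nV → MvPolynomial (Fin N) k ⧸ Id) (act (ω h)) (α x)) ∧
      ∃ sw : TensorProduct (MvPolynomial (Fin N) k ⧸ Id)
            (Fin nV → MvPolynomial (Fin N) k ⧸ Id) (Fin nV → MvPolynomial (Fin N) k ⧸ Id)
          →ₗ[k] TensorProduct (MvPolynomial (Fin N) k ⧸ Id)
            (Fin nV → MvPolynomial (Fin N) k ⧸ Id) (Fin nV → MvPolynomial (Fin N) k ⧸ Id),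
        (∀ d d' : Fin nV → MvPolynomial (Fin N) k ⧸ Id,
          sw (TensorProduct.tmul _ d d') =
            TensorProduct.tmul _ (fun j => iB (d' j)) (fun j => iB (d j))) ∧
        (∀ x y : (Submodule.restrictScalars k (TwoSidedIdeal.asIdeal J : Ideal H)),
          (y : H) = ω (x : H) → α y = sw (α x))

/-- `H` admits an affine cell chain of length `n` with respect to the involution `ω`
(formulated recursively: there is an affine cell ideal `J` of `H` and the induced involution
on `H/J` admits a chain of length `n - 1`). -/
def AffineCellularChain (k : Type) [Field k] :
    ℕ → ∀ (H : Type) [Ring H] [Algebra k H], (H →ₗ[k] H) → Prop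
  | 0 => fun H _ _ _ => Subsingleton H
  | n + 1 => fun H _ _ ω =>
    ∃ J : TwoSidedIdeal H, IsAffineCellIdeal k H ω J ∧
      ∃ ω' : J.ringCon.Quotient →ₗ[k] J.ringCon.Quotient,
        (∀ h : H, ω' (RingCon.mk' J.ringCon h) = RingCon.mk' J.ringCon (ω h)) ∧
        AffineCellularChain k n J.ringCon.Quotient ω'

/-- A `k`-algebra `H` is affine cellular with respect to the `k`-involution `ω` if it admits
a finite affine cell chain. -/
def IsAffineCellular (k : Type) [Field k] (H : Type) [Ring H] [Algebra k H]
    (ω : H →ₗ[k] H) : Prop :=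
  IsKInvolution ω ∧ ∃ n : ℕ, AffineCellularChain k n H ω

end VVPaper


namespace VVPaper

/-! ## Cell layers with matrix coefficients -/

section CellLayer

variable {k : Type} [Field k] {H : Type} [Ring H] [Algebra k H]

/-- A layer `J / I` of an affine cell chain of `(H, ω)`, described on `H` itself and in matrix
form: the representation `rep` describes the bimodule `Δ`, with coefficients in `B`, and `coord`
identifies `J / I` with `Δ ⊗_B Δ'`, the space of square matrices over `B`. The involution on `B`
is the identity. -/
structure CellLayer (ω : H →ₗ[k] H) (I J : Submodule k H) : Type 1 where
  ι : Type
  [fintype : Fintype ι]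
  [decEq : DecidableEq ι]
  B : Type
  [commRing : CommRing B]
  [algebra : Algebra k B]
  [finiteType : Algebra.FiniteType k B]
  rep : H →ₐ[k] Matrix ι ι B
  coord : H →ₗ[k] Matrix ι ι B
  le : I ≤ J
  rep_eq_zero : ∀ x ∈ I, rep x = 0
  mul_mem : ∀ h, ∀ x ∈ J, h * x ∈ J
  map_mem : ∀ x ∈ J, ω x ∈ J
  coord_mul : ∀ h, ∀ x ∈ J, coord (h * x) = rep h * coord x
  coord_map : ∀ x ∈ J, coord (ω x) = (coord x).transpose
  coord_eq_zero : ∀ x ∈ J, coord x = 0 ↔ x ∈ I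
  coord_surj : ∀ M, ∃ x ∈ J, coord x = M

attribute [instance] CellLayer.fintype CellLayer.decEq CellLayer.commRing CellLayer.algebra
  CellLayer.finiteType

/-- `(H, ω)` has a finite chain of cell layers from `0` to `H`. -/
def HasCellChain (ω : H →ₗ[k] H) : Prop :=
  Relation.ReflTransGen (fun I J => Nonempty (CellLayer ω I J)) ⊥ ⊤

namespace CellLayer

variable {ω : H →ₗ[k] H} {I J : Submodule k H}

lemma coord_eq_zero_of_mem (L : CellLayer ω I J) {x : H} (hx : x ∈ I) : L.coord x = 0 :=
  (L.coord_eq_zero x (L.le hx)).2 hx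

lemma mul_mem_bot (L : CellLayer ω I J) (h : H) {x : H} (hx : x ∈ I) : h * x ∈ I := by
  rw [← L.coord_eq_zero _ (L.mul_mem h x (L.le hx)), L.coord_mul h x (L.le hx),
    L.coord_eq_zero_of_mem hx, mul_zero]

lemma map_mem_bot (L : CellLayer ω I J) {x : H} (hx : x ∈ I) : ω x ∈ I := by
  rw [← L.coord_eq_zero _ (L.map_mem x (L.le hx)), L.coord_map x (L.le hx),
    L.coord_eq_zero_of_mem hx, Matrix.transpose_zero]

lemma mul_mem_right (L : CellLayer ω I J) (hω : IsKInvolution ω) {x : H} (hx : x ∈ J) (h : H) :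
    x * h ∈ J := by
  rw [← hω.involutive (x * h), hω.map_mul]
  exact L.map_mem _ (L.mul_mem _ _ (L.map_mem x hx))

lemma coord_mul_right (L : CellLayer ω I J) (hω : IsKInvolution ω) {x : H} (hx : x ∈ J) (h : H) :
    L.coord (x * h) = L.coord x * (L.rep (ω h)).transpose := by
  rw [← hω.involutive (x * h), hω.map_mul, L.coord_map _ (L.mul_mem _ _ (L.map_mem x hx)),
    L.coord_mul _ _ (L.map_mem x hx), L.coord_map x hx, Matrix.transpose_mul,
    Matrix.transpose_transpose]

end CellLayer

/-- A linear map vanishing on the kernel of a surjective one factors through it. -/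
lemma exists_linearMap_comp_eq {V W U : Type} [AddCommGroup V] [Module k V] [AddCommGroup W]
    [Module k W] [AddCommGroup U] [Module k U] {p : V →ₗ[k] W} (hp : Function.Surjective p)
    {f : V →ₗ[k] U} (hf : ∀ x, p x = 0 → f x = 0) : ∃ g : W →ₗ[k] U, ∀ x, g (p x) = f x := by
  obtain ⟨s, hs⟩ := p.exists_rightInverse_of_surjective (LinearMap.range_eq_top.2 hp)
  refine ⟨f ∘ₗ s, fun x => ?_⟩
  rw [← sub_eq_zero, LinearMap.comp_apply, ← map_sub]
  apply hf
  rw [map_sub, ← LinearMap.comp_apply, hs, LinearMap.id_apply, sub_self]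

/-- An algebra homomorphism vanishing on the kernel of a surjective one factors through it. -/
lemma exists_algHom_comp_eq {Q R : Type} [Ring Q] [Algebra k Q] [Ring R] [Algebra k R]
    {p : H →ₐ[k] Q} (hp : Function.Surjective p) {f : H →ₐ[k] R}
    (hf : ∀ x, p x = 0 → f x = 0) : ∃ g : Q →ₐ[k] R, ∀ x, g (p x) = f x := by
  obtain ⟨g, hg⟩ := exists_linearMap_comp_eq (p := p.toLinearMap) (f := f.toLinearMap) hp hf
  refine ⟨AlgHom.ofLinearMap g ?_ ?_, hg⟩
  · simpa using hg 1
  · intro x y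
    obtain ⟨x, rfl⟩ := hp x
    obtain ⟨y, rfl⟩ := hp y
    have := hg (x * y)
    simp only [AlgHom.toLinearMap_apply, map_mul] at this hg
    rw [this, hg, hg]

/-- The space `Rⁿ ⊗ Rⁿ` as a space of matrices. -/
def tensorEquivMatrix (R : Type) [CommRing R] (n : ℕ) :
    ((Fin n → R) ⊗[R] (Fin n → R)) ≃ₗ[R] Matrix (Fin n) (Fin n) R :=
  TensorProduct.piScalarRight R R (Fin n → R) (Fin n) ≪≫ₗ
    Matrix.ofLinearEquiv R ≪≫ₗ Matrix.transposeLinearEquiv (Fin n) (Fin n) R R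

lemma tensorEquivMatrix_tmul (R : Type) [CommRing R] (n : ℕ) (x y : Fin n → R) :
    tensorEquivMatrix R n (x ⊗ₜ y) = Matrix.vecMulVec x y := by
  ext i j
  simp [tensorEquivMatrix, Matrix.vecMulVec_apply, mul_comm]

lemma tensorEquivMatrix_rTensor {R : Type} [CommRing R] {n : ℕ} (M : Matrix (Fin n) (Fin n) R)
    (t : (Fin n → R) ⊗[R] (Fin n → R)) :
    tensorEquivMatrix R n (LinearMap.rTensor _ (Matrix.toLinAlgEquiv' M) t) =
      M * tensorEquivMatrix R n t := by
  induction t with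
  | zero => simp
  | add x y hx hy => simp only [map_add, hx, hy, mul_add]
  | tmul x y =>
    simp [tensorEquivMatrix_tmul, Matrix.mul_vecMulVec]

lemma tensorEquivMatrix_lTensor {R : Type} [CommRing R] {n : ℕ} (M : Matrix (Fin n) (Fin n) R)
    (t : (Fin n → R) ⊗[R] (Fin n → R)) :
    tensorEquivMatrix R n (LinearMap.lTensor _ (Matrix.toLinAlgEquiv' M) t) =
      tensorEquivMatrix R n t * M.transpose := by
  induction t with
  | zero => simp
  | add x y hx hy => simp only [map_add, hx, hy, add_mul]
  | tmul x y =>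
    simp [tensorEquivMatrix_tmul, Matrix.vecMulVec_mul, Matrix.vecMul_transpose]

lemma tensorEquivMatrix_comm {R : Type} [CommRing R] {n : ℕ} (t : (Fin n → R) ⊗[R] (Fin n → R)) :
    tensorEquivMatrix R n (TensorProduct.comm R _ _ t) =
      (tensorEquivMatrix R n t).transpose := by
  induction t with
  | zero => simp
  | add x y hx hy => simp only [map_add, hx, hy, Matrix.transpose_add]
  | tmul x y =>
    ext i j
    simp [tensorEquivMatrix_tmul, Matrix.vecMulVec_apply, mul_comm]

end CellLayer

end VVPaper

namespace VVPaper

variable {k : Type} [Field k] {H : Type} [Ring H] [Algebra k H] {ω : H →ₗ[k] H}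

/-- The image of a cell layer `J / I` in a quotient of `H` by `I` is an affine cell ideal. -/
lemma CellLayer.isAffineCellIdeal {I J : Submodule k H} (L : CellLayer ω I J)
    (hω : IsKInvolution ω) {Q : Type} [Ring Q] [Algebra k Q] {π : H →ₐ[k] Q}
    (hπ : Function.Surjective π) (hker : ∀ x, π x = 0 ↔ x ∈ I) {ωQ : Q →ₗ[k] Q}
    (hωQ : ∀ x, ωQ (π x) = π (ω x)) {K : TwoSidedIdeal Q} (hK : ∀ x, π x ∈ K ↔ x ∈ J) :
    IsAffineCellIdeal k Q ωQ K := by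
  obtain ⟨N, f, hf⟩ := Algebra.FiniteType.iff_quotient_mvPolynomial''.1 L.finiteType
  let e : L.B ≃ₐ[k] (MvPolynomial (Fin N) k ⧸ RingHom.ker f) :=
    (Ideal.quotientKerAlgEquivOfSurjective hf).symm
  let R := MvPolynomial (Fin N) k ⧸ RingHom.ker f
  let n := Fintype.card L.ι
  let G : Matrix L.ι L.ι L.B ≃ₐ[k] Matrix (Fin n) (Fin n) R :=
    (Matrix.reindexAlgEquiv k L.B (Fintype.equivFin L.ι)).trans e.mapMatrix
  have hG : ∀ M, G M.transpose = (G M).transpose := fun M => by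
    ext i j
    simp [G, Matrix.coe_reindexAlgEquiv]
  obtain ⟨rep, hrep⟩ := exists_algHom_comp_eq (p := π) (f := G.toAlgHom.comp L.rep) hπ
    (fun x hx => by simp [L.rep_eq_zero x ((hker x).1 hx)])
  obtain ⟨s, hs⟩ := (L.coord ∘ₗ J.subtype).exists_rightInverse_of_surjective
    (LinearMap.range_eq_top.2 fun M => by
      obtain ⟨x, hx, rfl⟩ := L.coord_surj M
      exact ⟨⟨x, hx⟩, rfl⟩)
  replace hs : ∀ M, L.coord (s M : H) = M := fun M => LinearMap.congr_fun hs M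
  have hsJ : ∀ x ∈ J, π (s (L.coord x) : H) = π x := fun x hx => by
    rw [← sub_eq_zero, ← map_sub, hker, ← L.coord_eq_zero _ (J.sub_mem (s _).2 hx), map_sub, hs,
      sub_self]
  let b : Matrix L.ι L.ι L.B →ₗ[k] (Submodule.restrictScalars k (K.asIdeal : Ideal Q)) :=
    LinearMap.codRestrict _ (π.toLinearMap ∘ₗ J.subtype ∘ₗ s) fun M =>
      TwoSidedIdeal.mem_asIdeal.2 ((hK _).2 (s M).2)
  have hb : Function.Bijective b := by
    constructor
    · rw [injective_iff_map_eq_zero]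
      intro M hM
      have h : π (s M : H) = 0 := congrArg Subtype.val hM
      rw [← hs M]
      exact L.coord_eq_zero_of_mem ((hker _).1 h)
    · rintro ⟨q, hq⟩
      obtain ⟨x, rfl⟩ := hπ q
      exact ⟨L.coord x, Subtype.ext (hsJ x ((hK x).1 (TwoSidedIdeal.mem_asIdeal.1 hq)))⟩
  let β := LinearEquiv.ofBijective b hb
  have hβ : ∀ (y : Submodule.restrictScalars k (K.asIdeal : Ideal Q)) (x : H), x ∈ J →
      (y : Q) = π x → β.symm y = L.coord x := fun y x hx hy => by
    rw [LinearEquiv.symm_apply_eq]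
    exact Subtype.ext (hy.trans (hsJ x hx).symm)
  have hlift : ∀ y : Submodule.restrictScalars k (K.asIdeal : Ideal Q), ∃ x ∈ J, (y : Q) = π x :=
    fun ⟨y, hy⟩ => by
      obtain ⟨x, rfl⟩ := hπ y
      exact ⟨x, (hK x).1 (TwoSidedIdeal.mem_asIdeal.1 hy), rfl⟩
  let γ := (tensorEquivMatrix R n).restrictScalars k
  have hγ : ∀ M, tensorEquivMatrix R n (γ.symm M) = M := fun M => γ.apply_symm_apply M
  have hωJ : ∀ x, ω x ∈ J → x ∈ J := fun x hx => hω.involutive x ▸ L.map_mem _ hx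
  refine ⟨fun q => ?_, n, N, RingHom.ker f, AlgEquiv.refl, fun _ => rfl,
    ((Matrix.toLinAlgEquiv' (R := R) (n := Fin n)).restrictScalars k).toAlgHom.comp rep,
    β.symm ≪≫ₗ G.toLinearEquiv ≪≫ₗ γ.symm, ?_, ?_,
    (TensorProduct.comm R (Fin n → R) (Fin n → R)).toLinearMap.restrictScalars k,
    fun d d' => rfl, ?_⟩
  · obtain ⟨x, rfl⟩ := hπ q
    rw [hωQ, hK, hK]
    exact ⟨L.map_mem x, hωJ x⟩
  · intro q x y hy
    obtain ⟨h, rfl⟩ := hπ q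
    obtain ⟨x', hx', hx⟩ := hlift x
    rw [hx, ← map_mul] at hy
    apply (tensorEquivMatrix R n).injective
    refine Eq.trans ?_ (tensorEquivMatrix_rTensor (rep (π h)) _).symm
    simp only [LinearEquiv.trans_apply, hγ, hβ x x' hx' hx, hβ y _ (L.mul_mem h x' hx') hy, hrep,
      L.coord_mul h x' hx']
    exact map_mul G _ _
  · intro q x y hy
    obtain ⟨h, rfl⟩ := hπ q
    obtain ⟨x', hx', hx⟩ := hlift x
    rw [hx, ← map_mul] at hy
    apply (tensorEquivMatrix R n).injective
    refine Eq.trans ?_ (tensorEquivMatrix_lTensor (rep (ωQ (π h))) _).symm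
    simp only [LinearEquiv.trans_apply, hγ, hβ x x' hx' hx,
      hβ y _ (L.mul_mem_right hω hx' h) hy, hωQ, hrep, L.coord_mul_right hω hx']
    exact (map_mul G _ _).trans (congrArg _ (hG _))
  · intro x y hy
    obtain ⟨x', hx', hx⟩ := hlift x
    rw [hx, hωQ] at hy
    apply (tensorEquivMatrix R n).injective
    refine Eq.trans ?_ (tensorEquivMatrix_comm _).symm
    simp only [LinearEquiv.trans_apply, hγ, hβ x x' hx' hx, hβ y _ (L.map_mem x' hx') hy,
      L.coord_map x' hx']
    exact hG _

/-- A chain of cell layers from `I` to `H` gives an affine cell chain of any quotient of `H`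
by `I`. -/
lemma affineCellularChain_of_reflTransGen (hω : IsKInvolution ω) {I : Submodule k H}
    (hI : Relation.ReflTransGen (fun I J => Nonempty (CellLayer ω I J)) I ⊤) :
    ∀ (Q : Type) [Ring Q] [Algebra k Q] (π : H →ₐ[k] Q), Function.Surjective π →
      (∀ x, π x = 0 ↔ x ∈ I) → ∀ ωQ : Q →ₗ[k] Q, (∀ x, ωQ (π x) = π (ω x)) →
        ∃ n, AffineCellularChain k n Q ωQ := by
  induction hI using Relation.ReflTransGen.head_induction_on with
  | refl =>
    intro Q _ _ π hπ hker ωQ _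
    refine ⟨0, ⟨fun a b => ?_⟩⟩
    obtain ⟨x, rfl⟩ := hπ a
    obtain ⟨y, rfl⟩ := hπ b
    rw [(hker x).2 trivial, (hker y).2 trivial]
  | @head I J hIJ _ ih =>
    obtain ⟨L⟩ := hIJ
    intro Q _ _ π hπ hker ωQ hωQ
    let K : TwoSidedIdeal Q := TwoSidedIdeal.mk' (π '' J) ⟨0, J.zero_mem, map_zero π⟩
      (by
        rintro _ _ ⟨x, hx, rfl⟩ ⟨y, hy, rfl⟩
        exact ⟨x + y, J.add_mem hx hy, map_add π x y⟩)
      (by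
        rintro _ ⟨x, hx, rfl⟩
        exact ⟨-x, J.neg_mem hx, map_neg π x⟩)
      (by
        rintro q _ ⟨x, hx, rfl⟩
        obtain ⟨h, rfl⟩ := hπ q
        exact ⟨h * x, L.mul_mem h x hx, map_mul π h x⟩)
      (by
        rintro _ q ⟨x, hx, rfl⟩
        obtain ⟨h, rfl⟩ := hπ q
        exact ⟨x * h, L.mul_mem_right hω hx h, map_mul π x h⟩)
    have hK : ∀ x, π x ∈ K ↔ x ∈ J := fun x => by
      refine (TwoSidedIdeal.mem_mk' _ _ _ _ _ _ _).trans ⟨?_, fun hx => ⟨x, hx, rfl⟩⟩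
      rintro ⟨y, hy, hxy⟩
      have : x - y ∈ I := by rw [← hker, map_sub, hxy, sub_self]
      simpa using J.add_mem (L.le this) hy
    let p : Q →ₐ[k] K.ringCon.Quotient := K.ringCon.mkₐ (α := k)
    have hp : ∀ q, p q = 0 ↔ q ∈ K := fun q => by
      rw [TwoSidedIdeal.mem_iff]
      exact RingCon.eq K.ringCon (a := q) (b := 0)
    have hps : Function.Surjective p := K.ringCon.mkₐ_surjective
    have hpπ : ∀ x, p (π x) = 0 ↔ x ∈ J := fun x => (hp _).trans (hK x)
    obtain ⟨ω', hω'⟩ := exists_linearMap_comp_eq (p := p.toLinearMap)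
      (f := p.toLinearMap ∘ₗ ωQ) hps (fun q hq => by
        obtain ⟨x, rfl⟩ := hπ q
        change p (ωQ (π x)) = 0
        rw [hωQ, hpπ]
        exact L.map_mem x ((hpπ x).1 hq))
    obtain ⟨n, hn⟩ := ih K.ringCon.Quotient (p.comp π) (hps.comp hπ) hpπ ω'
      (fun x => (hω' (π x)).trans (congrArg p (hωQ x)))
    exact ⟨n + 1, K, L.isAffineCellIdeal hω hπ hker hωQ hK, ω', hω', hn⟩

lemma HasCellChain.isAffineCellular (hω : IsKInvolution ω) (h : HasCellChain ω) :
    IsAffineCellular k H ω :=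
  ⟨hω, affineCellularChain_of_reflTransGen hω h H (AlgHom.id k H) Function.surjective_id
    (fun _ => Iff.rfl) ω fun _ => rfl⟩

end VVPaper

namespace VVPaper

section Tensor

variable {k : Type} [Field k] {H : Type} [Ring H] [Algebra k H] {ω : H →ₗ[k] H}
  {H' : Type} [Ring H'] [Algebra k H'] {ω' : H' →ₗ[k] H'}

lemma IsKInvolution.tensor (hω : IsKInvolution ω) (hω' : IsKInvolution ω') :
    IsKInvolution (TensorProduct.map ω ω') where
  map_mul a b := by
    induction a with
    | zero => simp
    | add x y hx hy => simp only [add_mul, mul_add, map_add, hx, hy]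
    | tmul x x' =>
      induction b with
      | zero => simp
      | add x y hx hy => simp only [add_mul, mul_add, map_add, hx, hy]
      | tmul y y' => simp [hω.map_mul, hω'.map_mul]
  map_one := by simp [Algebra.TensorProduct.one_def, hω.map_one, hω'.map_one]
  involutive a := by
    induction a with
    | zero => simp
    | add x y hx hy => simp only [map_add, hx, hy]
    | tmul x x' => simp [hω.involutive, hω'.involutive]

/-- The span of the tensors `x ⊗ y` with `x ∈ I` and `y ∈ I'`. -/
abbrev tensorSpan (I : Submodule k H) (I' : Submodule k H') : Submodule k (H ⊗[k] H') :=
  Submodule.map₂ (TensorProduct.mk k H H') I I'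

lemma tensorSpan_le_comap {M : Type} [AddCommGroup M] [Module k M] {I : Submodule k H}
    {I' : Submodule k H'} {K : Submodule k M} {f : H ⊗[k] H' →ₗ[k] M}
    (h : ∀ x ∈ I, ∀ y ∈ I', f (x ⊗ₜ y) ∈ K) : ∀ t ∈ tensorSpan I I', f t ∈ K := by
  have : tensorSpan I I' ≤ K.comap f := Submodule.map₂_le.2 h
  exact this

lemma tensorSpan_induction {I : Submodule k H} {I' : Submodule k H'} {M : Type} [AddCommGroup M]
    [Module k M] {f g : H ⊗[k] H' →ₗ[k] M}
    (h : ∀ x ∈ I, ∀ y ∈ I', f (x ⊗ₜ y) = g (x ⊗ₜ y)) : ∀ t ∈ tensorSpan I I', f t = g t := by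
  have : tensorSpan I I' ≤ LinearMap.eqLocus f g := Submodule.map₂_le.2 h
  exact this

lemma tmul_mem_tensorSpan {I : Submodule k H} {I' : Submodule k H'} {x : H} {y : H'} (hx : x ∈ I)
    (hy : y ∈ I') : x ⊗ₜ[k] y ∈ tensorSpan I I' :=
  Submodule.apply_mem_map₂ _ hx hy

lemma mem_sup_of_map_eq_zero {I J : Submodule k H} {I' J' : Submodule k H'} {M M' : Type}
    [AddCommGroup M] [Module k M] [AddCommGroup M'] [Module k M'] {f : H →ₗ[k] M}
    {f' : H' →ₗ[k] M'} (hf : ∀ x ∈ J, f x = 0 → x ∈ I) (hf' : ∀ x ∈ J', f' x = 0 → x ∈ I')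
    (hs : ∀ m, ∃ x ∈ J, f x = m) (hs' : ∀ m, ∃ x ∈ J', f' x = m) {t : H ⊗[k] H'}
    (ht : t ∈ tensorSpan J J') (h0 : TensorProduct.map f f' t = 0) :
    t ∈ tensorSpan I ⊤ ⊔ tensorSpan J I' := by
  obtain ⟨t, rfl⟩ : ∃ s, TensorProduct.map J.subtype J'.subtype s = t := by
    have : tensorSpan J J' ≤ LinearMap.range (TensorProduct.map J.subtype J'.subtype) :=
      Submodule.map₂_le.2 fun x hx y hy => ⟨(⟨x, hx⟩ : J) ⊗ₜ[k] (⟨y, hy⟩ : J'), rfl⟩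
    exact this ht
  have hg : Function.Surjective (f ∘ₗ J.subtype) := fun m => by
    obtain ⟨x, hx, rfl⟩ := hs m
    exact ⟨⟨x, hx⟩, rfl⟩
  have hg' : Function.Surjective (f' ∘ₗ J'.subtype) := fun m => by
    obtain ⟨x, hx, rfl⟩ := hs' m
    exact ⟨⟨x, hx⟩, rfl⟩
  have hker := TensorProduct.map_ker (LinearMap.exact_subtype_ker_map _) hg
    (LinearMap.exact_subtype_ker_map _) hg'
  rw [← LinearMap.comp_apply, ← TensorProduct.map_comp, ← LinearMap.mem_ker, hker] at h0
  obtain ⟨_, ⟨a, rfl⟩, _, ⟨b, rfl⟩, rfl⟩ := Submodule.mem_sup.1 h0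
  rw [map_add, add_comm]
  refine Submodule.add_mem_sup ?_ ?_
  · clear h0 ht
    induction b with
    | zero => simp
    | add x y hx hy => rw [map_add, map_add]; exact Submodule.add_mem _ hx hy
    | tmul x y => exact tmul_mem_tensorSpan (hf _ x.1.2 x.2) Submodule.mem_top
  · clear h0 ht
    induction a with
    | zero => simp
    | add x y hx hy => rw [map_add, map_add]; exact Submodule.add_mem _ hx hy
    | tmul x y => exact tmul_mem_tensorSpan x.2 (hf' _ y.1.2 y.2)

/-- The layer of `H ⊗ H'` given by the tensor product of a layer of `H` and a layer of `H'`. -/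
def CellLayer.tensor {I J : Submodule k H} {I' J' : Submodule k H'} (L : CellLayer ω I J)
    (L' : CellLayer ω' I' J') :
    CellLayer (TensorProduct.map ω ω') (tensorSpan I ⊤ ⊔ tensorSpan J I')
      (tensorSpan I ⊤ ⊔ tensorSpan J J') := by
  let e := Matrix.kroneckerTMulAlgEquiv L.ι L'.ι k k L.B L'.B
  have he : ∀ M, e (TensorProduct.map (Matrix.transposeLinearEquiv L.ι L.ι k L.B).toLinearMap
      (Matrix.transposeLinearEquiv L'.ι L'.ι k L'.B).toLinearMap M) = (e M).transpose := fun M => by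
    induction M with
    | zero => simp
    | add x y hx hy => simp only [map_add, hx, hy, Matrix.transpose_add]
    | tmul x y => rfl
  let rep : H ⊗[k] H' →ₐ[k] Matrix (L.ι × L'.ι) (L.ι × L'.ι) (L.B ⊗[k] L'.B) :=
    e.toAlgHom.comp (Algebra.TensorProduct.map L.rep L'.rep)
  let coord : H ⊗[k] H' →ₗ[k] Matrix (L.ι × L'.ι) (L.ι × L'.ι) (L.B ⊗[k] L'.B) :=
    e.toLinearMap ∘ₗ TensorProduct.map L.coord L'.coord
  have coord_left : ∀ t ∈ tensorSpan I (⊤ : Submodule k H'), coord t = 0 :=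
    tensorSpan_induction (g := 0) fun x hx y _ => by
      simp [coord, L.coord_eq_zero_of_mem hx]
  have coord_right : ∀ t ∈ tensorSpan J I', coord t = 0 :=
    tensorSpan_induction (g := 0) fun x _ y hy => by
      simp [coord, L'.coord_eq_zero_of_mem hy]
  have induction_sup : ∀ {P Q : Submodule k (H ⊗[k] H')} {C : H ⊗[k] H' → Prop},
      (∀ x y, C x → C y → C (x + y)) → (∀ x ∈ P, C x) → (∀ x ∈ Q, C x) → ∀ x ∈ P ⊔ Q, C x := by
    intro P Q C hC hP hQ x hx
    obtain ⟨y, hy, z, hz, rfl⟩ := Submodule.mem_sup.1 hx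
    exact hC _ _ (hP y hy) (hQ z hz)
  have mul_mem_left : ∀ h, ∀ t ∈ tensorSpan I (⊤ : Submodule k H'),
      h * t ∈ tensorSpan I (⊤ : Submodule k H') := fun h => by
    induction h with
    | zero => simp
    | add a b ha hb =>
      intro t ht
      rw [add_mul]
      exact Submodule.add_mem _ (ha t ht) (hb t ht)
    | tmul a b =>
      exact tensorSpan_le_comap (f := LinearMap.mulLeft k (a ⊗ₜ b)) fun x hx y hy => by
        simpa using tmul_mem_tensorSpan (L.mul_mem_bot a hx) (Submodule.mem_top (x := b * y))
  have mul_mem_right : ∀ h, ∀ t ∈ tensorSpan J J', h * t ∈ tensorSpan J J' := fun h => by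
    induction h with
    | zero => simp
    | add a b ha hb =>
      intro t ht
      rw [add_mul]
      exact Submodule.add_mem _ (ha t ht) (hb t ht)
    | tmul a b =>
      exact tensorSpan_le_comap (f := LinearMap.mulLeft k (a ⊗ₜ b)) fun x hx y hy => by
        simpa using tmul_mem_tensorSpan (L.mul_mem a x hx) (L'.mul_mem b y hy)
  have map_mem_left : ∀ t ∈ tensorSpan I (⊤ : Submodule k H'),
      TensorProduct.map ω ω' t ∈ tensorSpan I (⊤ : Submodule k H') :=
    tensorSpan_le_comap fun x hx y _ => tmul_mem_tensorSpan (L.map_mem_bot hx) Submodule.mem_top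
  exact
  { ι := L.ι × L'.ι
    B := L.B ⊗[k] L'.B
    finiteType := .trans L.finiteType inferInstance
    rep := rep
    coord := coord
    le := sup_le_sup_left (Submodule.map₂_le_map₂_right L'.le) _
    rep_eq_zero := by
      refine induction_sup (fun x y hx hy => by rw [map_add, hx, hy, add_zero]) ?_ ?_
      · exact tensorSpan_induction (f := rep.toLinearMap) (g := 0) fun x hx y _ => by
          simp [rep, L.rep_eq_zero x hx]
      · exact tensorSpan_induction (f := rep.toLinearMap) (g := 0) fun x _ y hy => by
          simp [rep, L'.rep_eq_zero y hy]
    mul_mem := fun h => induction_sup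
      (fun x y hx hy => by rw [mul_add]; exact Submodule.add_mem _ hx hy)
      (fun t ht => Submodule.mem_sup_left (mul_mem_left h t ht))
      (fun t ht => Submodule.mem_sup_right (mul_mem_right h t ht))
    map_mem := induction_sup
      (fun x y hx hy => by rw [map_add]; exact Submodule.add_mem _ hx hy)
      (fun t ht => Submodule.mem_sup_left (map_mem_left t ht))
      (fun t ht => Submodule.mem_sup_right (tensorSpan_le_comap
        (fun x hx y hy => tmul_mem_tensorSpan (L.map_mem x hx) (L'.map_mem y hy)) t ht))
    coord_mul := fun h => induction_sup
      (fun x y hx hy => by rw [mul_add, map_add, hx, hy, map_add, mul_add])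
      (fun t ht => by rw [coord_left t ht, coord_left _ (mul_mem_left h t ht), mul_zero])
      (by
        induction h with
        | zero => simp
        | add a b ha hb =>
          intro t ht
          rw [add_mul, map_add, ha t ht, hb t ht, map_add, add_mul]
        | tmul a b =>
          refine tensorSpan_induction (f := coord ∘ₗ LinearMap.mulLeft k (a ⊗ₜ b))
            (g := LinearMap.mulLeft k (rep (a ⊗ₜ b)) ∘ₗ coord) fun x hx y hy => ?_
          refine Eq.trans ?_ (map_mul e (L.rep a ⊗ₜ L'.rep b) (L.coord x ⊗ₜ L'.coord y))
          simp [coord, L.coord_mul a x hx, L'.coord_mul b y hy])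
    coord_map := induction_sup
      (fun x y hx hy => by rw [map_add, map_add, hx, hy, map_add, Matrix.transpose_add])
      (fun t ht => by
        rw [coord_left t ht, coord_left _ (map_mem_left t ht), Matrix.transpose_zero])
      (by
        refine tensorSpan_induction (f := coord ∘ₗ TensorProduct.map ω ω')
            (g := (Matrix.transposeLinearEquiv _ _ k _).toLinearMap ∘ₗ coord) fun x hx y hy => ?_
        refine Eq.trans ?_ (he (L.coord x ⊗ₜ L'.coord y))
        simp [coord, L.coord_map x hx, L'.coord_map y hy])
    coord_eq_zero := by
      intro t ht
      refine ⟨fun h => ?_, ?_⟩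
      · obtain ⟨y, hy, z, hz, rfl⟩ := Submodule.mem_sup.1 ht
        rw [map_add, coord_left y hy, zero_add] at h
        refine Submodule.add_mem _ (Submodule.mem_sup_left hy) ?_
        exact mem_sup_of_map_eq_zero (fun x hx => (L.coord_eq_zero x hx).1)
          (fun x hx => (L'.coord_eq_zero x hx).1) L.coord_surj L'.coord_surj hz
          (e.injective (h.trans (map_zero e).symm))
      · revert t
        exact fun t _ ht => induction_sup (C := fun t => coord t = 0)
          (fun x y hx hy => by rw [map_add, hx, hy, add_zero]) coord_left coord_right t ht
    coord_surj := by
      intro M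
      obtain ⟨M, rfl⟩ := e.surjective M
      induction M with
      | zero => exact ⟨0, Submodule.zero_mem _, by simp⟩
      | add x y hx hy =>
        obtain ⟨a, ha, hx⟩ := hx
        obtain ⟨b, hb, hy⟩ := hy
        exact ⟨a + b, Submodule.add_mem _ ha hb, by rw [map_add, hx, hy, map_add]⟩
      | tmul x y =>
        obtain ⟨a, ha, rfl⟩ := L.coord_surj x
        obtain ⟨b, hb, rfl⟩ := L'.coord_surj y
        exact ⟨a ⊗ₜ b, Submodule.mem_sup_right (tmul_mem_tensorSpan ha hb), rfl⟩ }

lemma HasCellChain.tensor (h : HasCellChain ω) (h' : HasCellChain ω') :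
    HasCellChain (TensorProduct.map ω ω') := by
  have step : ∀ I J : Submodule k H, Nonempty (CellLayer ω I J) →
      Relation.ReflTransGen (fun I J => Nonempty (CellLayer (TensorProduct.map ω ω') I J))
        (tensorSpan I ⊤) (tensorSpan J ⊤) := by
    rintro I J ⟨L⟩
    have := Relation.ReflTransGen.lift (fun I' => tensorSpan I ⊤ ⊔ tensorSpan J I')
      (p := fun I J => Nonempty (CellLayer (TensorProduct.map ω ω') I J))
      (fun I' J' hL => hL.map L.tensor) _ _ h'
    have hle : tensorSpan I (⊤ : Submodule k H') ≤ tensorSpan J ⊤ :=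
      Submodule.map₂_le_map₂_left L.le
    simpa [tensorSpan, Function.onFun, sup_eq_right.2 hle] using this
  have := Relation.ReflTransGen.lift' (fun I => tensorSpan I (⊤ : Submodule k H'))
    (p := fun I J => Nonempty (CellLayer (TensorProduct.map ω ω') I J)) step _ _ h
  have htop : tensorSpan (⊤ : Submodule k H) (⊤ : Submodule k H') = ⊤ :=
    TensorProduct.map₂_mk_top_top_eq_top k H H'
  rw [Function.onFun, htop] at this
  simpa [tensorSpan, HasCellChain] using this

lemma hasCellChain_id : HasCellChain (LinearMap.id : k →ₗ[k] k) :=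
  .single ⟨{
    ι := Unit
    B := k
    rep := Matrix.scalarAlgHom Unit k
    coord := (Matrix.scalarAlgHom Unit k).toLinearMap
    le := bot_le
    rep_eq_zero := fun x hx => by rw [(Submodule.mem_bot k).1 hx, map_zero]
    mul_mem := by simp
    map_mem := by simp
    coord_mul := fun h x _ => map_mul (Matrix.scalarAlgHom Unit k) h x
    coord_map := fun x _ => by simp
    coord_eq_zero := fun x _ => by
      rw [Submodule.mem_bot]
      exact map_eq_zero_iff (Matrix.scalar Unit) fun _ _ => Matrix.scalar_inj.1
    coord_surj := fun M => ⟨M () (), trivial, by ext; simp⟩ }⟩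

end Tensor

end VVPaper

namespace VVPaper

section PathAlgebra

variable (k : Type) [Field k]

lemma aE1_mul_aE1 : aE1 k * aE1 k = aE1 k := by
  simpa only [aE1, pmk, map_mul] using RingQuot.mkAlgHom_rel k (PRel.e1_idem (k := k))

lemma aE2_mul_aE2 : aE2 k * aE2 k = aE2 k := by
  simpa only [aE2, pmk, map_mul] using RingQuot.mkAlgHom_rel k (PRel.e2_idem (k := k))

lemma aE1_mul_aE2 : aE1 k * aE2 k = 0 := by
  simpa only [aE1, aE2, pmk, map_mul, map_zero] using
    RingQuot.mkAlgHom_rel k (PRel.orth12 (k := k))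

lemma aE2_mul_aE1 : aE2 k * aE1 k = 0 := by
  simpa only [aE1, aE2, pmk, map_mul, map_zero] using
    RingQuot.mkAlgHom_rel k (PRel.orth21 (k := k))

lemma aE1_add_aE2 : aE1 k + aE2 k = 1 := by
  simpa only [aE1, aE2, pmk, map_add, map_one] using
    RingQuot.mkAlgHom_rel k (PRel.sum_eq_one (k := k))

lemma aE2_mul_aU1 : aE2 k * aU1 k = aU1 k := by
  simpa only [aE2, aU1, pmk, map_mul] using RingQuot.mkAlgHom_rel k (PRel.u1_tgt (k := k))

lemma aU1_mul_aE1 : aU1 k * aE1 k = aU1 k := by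
  simpa only [aE1, aU1, pmk, map_mul] using RingQuot.mkAlgHom_rel k (PRel.u1_src (k := k))

lemma aE1_mul_aU2 : aE1 k * aU2 k = aU2 k := by
  simpa only [aE1, aU2, pmk, map_mul] using RingQuot.mkAlgHom_rel k (PRel.u2_tgt (k := k))

lemma aU2_mul_aE2 : aU2 k * aE2 k = aU2 k := by
  simpa only [aE2, aU2, pmk, map_mul] using RingQuot.mkAlgHom_rel k (PRel.u2_src (k := k))

lemma aE1_mul_aU1 : aE1 k * aU1 k = 0 := by
  rw [← aE2_mul_aU1, ← mul_assoc, aE1_mul_aE2, zero_mul]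

lemma aU1_mul_aE2 : aU1 k * aE2 k = 0 := by
  rw [← aU1_mul_aE1, mul_assoc, aE1_mul_aE2, mul_zero]

lemma aE2_mul_aU2 : aE2 k * aU2 k = 0 := by
  rw [← aE1_mul_aU2, ← mul_assoc, aE2_mul_aE1, zero_mul]

lemma aU2_mul_aE1 : aU2 k * aE1 k = 0 := by
  rw [← aU2_mul_aE2, mul_assoc, aE2_mul_aE1, mul_zero]

lemma aU1_mul_aU1 : aU1 k * aU1 k = 0 := by
  rw [← aE2_mul_aU1, ← mul_assoc, mul_assoc (aE2 k), aU1_mul_aE2, mul_zero, zero_mul]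

lemma aU2_mul_aU2 : aU2 k * aU2 k = 0 := by
  rw [← aE1_mul_aU2, ← mul_assoc, mul_assoc (aE1 k), aU2_mul_aE1, mul_zero, zero_mul]

variable {k}

@[elab_as_elim]
lemma PathA.induction {P : PathA k → Prop} (scalar : ∀ c, P (algebraMap k _ c))
    (e1 : P (aE1 k)) (e2 : P (aE2 k)) (u1 : P (aU1 k)) (u2 : P (aU2 k))
    (add : ∀ x y, P x → P y → P (x + y)) (mul : ∀ x y, P x → P y → P (x * y)) (x : PathA k) :
    P x := by
  obtain ⟨x, rfl⟩ := RingQuot.mkAlgHom_surjective k (PRel k) x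
  induction x using FreeAlgebra.induction with
  | grade0 r => simpa using scalar r
  | grade1 g =>
    cases g
    exacts [e1, e2, u1, u2]
  | mul a b ha hb => simpa using mul _ _ ha hb
  | add a b ha hb => simpa using add _ _ ha hb

/-- The images of the generators under the homomorphism sending them to `a`, `b`, `c`, `d`. -/
def PGen.elim {R : Type} (a b c d : R) : PGen → R
  | .e1 => a
  | .e2 => b
  | .u1 => c
  | .u2 => d

/-- The universal property of the path algebra. -/
lemma PathA.exists_algHom {R : Type} [Ring R] [Algebra k R] {a b c d : R} (haa : a * a = a)
    (hbb : b * b = b) (hab : a * b = 0) (hba : b * a = 0) (h1 : a + b = 1) (hbc : b * c = c)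
    (hca : c * a = c) (had : a * d = d) (hdb : d * b = d) :
    ∃ f : PathA k →ₐ[k] R, f (aE1 k) = a ∧ f (aE2 k) = b ∧ f (aU1 k) = c ∧ f (aU2 k) = d := by
  let g : FreeAlgebra k PGen →ₐ[k] R := FreeAlgebra.lift k (PGen.elim a b c d)
  have hg : ∀ x y, PRel k x y → g x = g y := by
    intro x y h
    cases h <;> simp [g, gE1, gE2, gU1, gU2, PGen.elim, *]
  refine ⟨RingQuot.liftAlgHom k ⟨g, @hg⟩, ?_, ?_, ?_, ?_⟩
  · exact (RingQuot.liftAlgHom_mkAlgHom_apply k g hg _).trans (by simp [g, gE1, PGen.elim])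
  · exact (RingQuot.liftAlgHom_mkAlgHom_apply k g hg _).trans (by simp [g, gE2, PGen.elim])
  · exact (RingQuot.liftAlgHom_mkAlgHom_apply k g hg _).trans (by simp [g, gU1, PGen.elim])
  · exact (RingQuot.liftAlgHom_mkAlgHom_apply k g hg _).trans (by simp [g, gU2, PGen.elim])

variable (k) in
/-- The anti-involution of the path algebra fixing the vertices and swapping the arrows. -/
lemma PathA.exists_involution : ∃ τ : PathA k →ₗ[k] PathA k, IsKInvolution τ ∧
    τ (aE1 k) = aE1 k ∧ τ (aE2 k) = aE2 k ∧ τ (aU1 k) = aU2 k ∧ τ (aU2 k) = aU1 k := by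
  obtain ⟨f, h1, h2, h3, h4⟩ := PathA.exists_algHom (k := k) (R := (PathA k)ᵐᵒᵖ)
    (a := .op (aE1 k)) (b := .op (aE2 k)) (c := .op (aU2 k)) (d := .op (aU1 k))
    (by rw [← MulOpposite.op_mul, aE1_mul_aE1]) (by rw [← MulOpposite.op_mul, aE2_mul_aE2])
    (by rw [← MulOpposite.op_mul, aE2_mul_aE1, MulOpposite.op_zero])
    (by rw [← MulOpposite.op_mul, aE1_mul_aE2, MulOpposite.op_zero])
    (by rw [← MulOpposite.op_add, aE1_add_aE2, MulOpposite.op_one])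
    (by rw [← MulOpposite.op_mul, aU2_mul_aE2]) (by rw [← MulOpposite.op_mul, aE1_mul_aU2])
    (by rw [← MulOpposite.op_mul, aU1_mul_aE1]) (by rw [← MulOpposite.op_mul, aE2_mul_aU1])
  let τ : PathA k →ₗ[k] PathA k := (MulOpposite.opLinearEquiv k).symm.toLinearMap ∘ₗ f.toLinearMap
  have hτ : ∀ x, τ x = (f x).unop := fun x => rfl
  refine ⟨τ, ⟨fun a b => ?_, ?_, fun a => ?_⟩, ?_, ?_, ?_, ?_⟩
  · simp [hτ]
  · simp [hτ]
  · induction a using PathA.induction with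
    | scalar c => simp [hτ]
    | e1 => simp [hτ, h1]
    | e2 => simp [hτ, h2]
    | u1 => simp [hτ, h3, h4]
    | u2 => simp [hτ, h3, h4]
    | add x y hx hy => rw [map_add, map_add, hx, hy]
    | mul x y hx hy =>
      simp only [hτ] at hx hy
      simp [hτ, hx, hy]
  all_goals simp [hτ, h1, h2, h3, h4]

open Polynomial

variable (k) in
/-- The central element of degree two of the path algebra. -/
def PathA.center : PathA k := aU1 k * aU2 k + aU2 k * aU1 k

lemma PathA.commute_center (x : PathA k) : Commute (PathA.center k) x := by
  induction x using PathA.induction with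
  | scalar c => exact (Algebra.commutes c _).symm
  | e1 =>
    simp [Commute, SemiconjBy, center, add_mul, mul_add, mul_assoc, aU2_mul_aE1, aU1_mul_aE1,
      ← mul_assoc (aE1 k), aE1_mul_aU1, aE1_mul_aU2]
  | e2 =>
    simp [Commute, SemiconjBy, center, add_mul, mul_add, mul_assoc, aU2_mul_aE2, aU1_mul_aE2,
      ← mul_assoc (aE2 k), aE2_mul_aU1, aE2_mul_aU2]
  | u1 =>
    simp [Commute, SemiconjBy, center, add_mul, mul_add, mul_assoc, aU1_mul_aU1,
      ← mul_assoc (aU1 k) (aU1 k)]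
  | u2 =>
    simp [Commute, SemiconjBy, center, add_mul, mul_add, mul_assoc, aU2_mul_aU2,
      ← mul_assoc (aU2 k) (aU2 k)]
  | add x y hx hy => exact hx.add_right hy
  | mul x y hx hy => exact hx.mul_right hy

lemma PathA.commute_aeval_center (p : k[X]) (x : PathA k) :
    Commute (aeval (center k) p) x := by
  induction p using Polynomial.induction_on' with
  | add p q hp hq => rw [map_add]; exact hp.add_left hq
  | monomial n c =>
    rw [aeval_monomial]
    exact Commute.mul_left (Algebra.commutes c x) ((commute_center x).pow_left n)

variable (k) in
/-- The parametrization of the ideal generated by `e₁` by matrices with polynomial entries. -/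
def PathA.ofMatrix : Matrix (Fin 2) (Fin 2) k[X] →ₗ[k] PathA k where
  toFun M := aeval (center k) (M 0 0) * aE1 k + aeval (center k) (M 1 0) * aU1 k +
    (aeval (center k) (M 0 1) * aU2 k + aeval (center k) (M 1 1) * (aU1 k * aU2 k))
  map_add' M M' := by
    simp only [Matrix.add_apply, map_add, add_mul]
    abel
  map_smul' c M := by simp [smul_add]

lemma PathA.ofMatrix_apply (M : Matrix (Fin 2) (Fin 2) k[X]) : ofMatrix k M =
    aeval (center k) (M 0 0) * aE1 k + aeval (center k) (M 1 0) * aU1 k +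
    (aeval (center k) (M 0 1) * aU2 k + aeval (center k) (M 1 1) * (aU1 k * aU2 k)) := rfl

variable (k) in
/-- The representation of the path algebra on the left ideal generated by `e₁`. -/
lemma PathA.exists_matrixRep : ∃ ρ : PathA k →ₐ[k] Matrix (Fin 2) (Fin 2) k[X],
    ρ (aE1 k) = !![1, 0; 0, 0] ∧ ρ (aE2 k) = !![0, 0; 0, 1] ∧ ρ (aU1 k) = !![0, 0; 1, 0] ∧
      ρ (aU2 k) = !![0, X; 0, 0] := by
  apply PathA.exists_algHom
  all_goals
    ext i j
    fin_cases i <;> fin_cases j <;> simp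

lemma PathA.center_mul_aE1 : center k * aE1 k = aU2 k * aU1 k := by
  rw [center, add_mul, mul_assoc, mul_assoc, aU2_mul_aE1, aU1_mul_aE1, mul_zero, zero_add]

lemma PathA.center_mul_aU2 : center k * aU2 k = aU2 k * (aU1 k * aU2 k) := by
  rw [center, add_mul, mul_assoc, mul_assoc, aU2_mul_aU2, mul_zero, zero_add]

/-- `ofMatrix` intertwines the representation `ρ` with left multiplication. -/
lemma PathA.ofMatrix_mul {ρ : PathA k →ₐ[k] Matrix (Fin 2) (Fin 2) k[X]}
    (h1 : ρ (aE1 k) = !![1, 0; 0, 0]) (h2 : ρ (aE2 k) = !![0, 0; 0, 1])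
    (h3 : ρ (aU1 k) = !![0, 0; 1, 0]) (h4 : ρ (aU2 k) = !![0, X; 0, 0]) (x : PathA k) :
    ∀ M, ofMatrix k (ρ x * M) = x * ofMatrix k M := by
  have key : ∀ (p : k[X]) (x y : PathA k),
      x * (aeval (center k) p * y) = aeval (center k) p * (x * y) := fun p x y => by
    rw [← mul_assoc, ← (commute_aeval_center p x).eq, mul_assoc]
  induction x using PathA.induction with
  | scalar c => intro M; simp [Algebra.algebraMap_eq_smul_one]
  | e1 =>
    intro M
    simp [h1, ofMatrix_apply, mul_add, key, aE1_mul_aE1, aE1_mul_aU1, aE1_mul_aU2,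
      ← mul_assoc (aE1 k), Matrix.vecMul, dotProduct]
  | e2 =>
    intro M
    simp [h2, ofMatrix_apply, mul_add, key, aE2_mul_aE1, aE2_mul_aU1, aE2_mul_aU2,
      ← mul_assoc (aE2 k), Matrix.vecMul, dotProduct]
  | u1 =>
    intro M
    simp [h3, ofMatrix_apply, mul_add, key, aU1_mul_aE1, aU1_mul_aU1,
      ← mul_assoc (aU1 k) (aU1 k), Matrix.vecMul, dotProduct]
  | u2 =>
    intro M
    simp [h4, ofMatrix_apply, mul_add, key, aU2_mul_aE1, aU2_mul_aU2, Matrix.vecMul, dotProduct,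
      mul_comm X, mul_assoc, center_mul_aE1, center_mul_aU2]
  | add x y hx hy => intro M; rw [map_add ρ, add_mul, map_add, hx, hy, add_mul]
  | mul x y hx hy => intro M; rw [map_mul ρ, mul_assoc, hx, hy, mul_assoc]

lemma PathA.rep_ofMatrix {ρ : PathA k →ₐ[k] Matrix (Fin 2) (Fin 2) k[X]}
    (h1 : ρ (aE1 k) = !![1, 0; 0, 0]) (h3 : ρ (aU1 k) = !![0, 0; 1, 0])
    (h4 : ρ (aU2 k) = !![0, X; 0, 0]) (M : Matrix (Fin 2) (Fin 2) k[X]) :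
    ρ (ofMatrix k M) = !![M 0 0, X * M 0 1; M 1 0, X * M 1 1] := by
  have hc : ρ (center k) = algebraMap k[X] _ X := by
    rw [center, map_add, map_mul, map_mul, h3, h4, Matrix.algebraMap_eq_diagonal]
    ext i j
    fin_cases i <;> fin_cases j <;> simp
  have hp : ∀ p : k[X], ρ (aeval (center k) p) = algebraMap k[X] _ p := fun p => by
    rw [← aeval_algHom_apply, hc, aeval_algebraMap_apply, aeval_X_left_apply]
  simp only [ofMatrix_apply, map_add, map_mul, hp, h1, h3, h4, ← Algebra.smul_def]
  ext i j
  fin_cases i <;> fin_cases j <;> simp [mul_comm X]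

lemma PathA.ofMatrix_injective : Function.Injective (ofMatrix k) := by
  obtain ⟨ρ, h1, -, h3, h4⟩ := exists_matrixRep k
  rw [injective_iff_map_eq_zero]
  intro M hM
  have h := rep_ofMatrix h1 h3 h4 M
  rw [hM, map_zero] at h
  ext1 i j
  have hij := congrFun (congrFun h.symm i) j
  fin_cases i <;> fin_cases j <;> simpa using hij

lemma PathA.map_ofMatrix {τ : PathA k →ₗ[k] PathA k} (hτ : IsKInvolution τ)
    (h1 : τ (aE1 k) = aE1 k) (h3 : τ (aU1 k) = aU2 k) (h4 : τ (aU2 k) = aU1 k)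
    (M : Matrix (Fin 2) (Fin 2) k[X]) : τ (ofMatrix k M) = ofMatrix k M.transpose := by
  have hc : τ (center k) = center k := by
    rw [center, map_add, hτ.map_mul, hτ.map_mul, h3, h4]
  have hpow : ∀ n : ℕ, τ (center k ^ n) = center k ^ n := fun n => by
    induction n with
    | zero => rw [pow_zero, hτ.map_one]
    | succ n ih => rw [pow_succ, hτ.map_mul, ih, hc, ← pow_succ, ← pow_succ']
  have hp : ∀ p : k[X], τ (aeval (center k) p) = aeval (center k) p := fun p => by
    induction p using Polynomial.induction_on' with
    | add p q hp hq => rw [map_add, map_add, hp, hq]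
    | monomial n c => rw [aeval_monomial, ← Algebra.smul_def, map_smul, hpow]
  have key : ∀ (p : k[X]) (x : PathA k),
      τ (aeval (center k) p * x) = aeval (center k) p * τ x := fun p x => by
    rw [hτ.map_mul, hp, (commute_aeval_center p _).eq]
  simp only [ofMatrix_apply, map_add, key, hτ.map_mul (aU1 k), h1, h3, h4, Matrix.transpose_apply]
  abel

variable (k) in
/-- The one-dimensional representation of the path algebra supported at `e₂`. -/
lemma PathA.exists_counit : ∃ ε : PathA k →ₐ[k] k,
    ε (aE1 k) = 0 ∧ ε (aE2 k) = 1 ∧ ε (aU1 k) = 0 ∧ ε (aU2 k) = 0 := by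
  apply PathA.exists_algHom <;> simp

lemma PathA.counit_ofMatrix {ε : PathA k →ₐ[k] k} (h1 : ε (aE1 k) = 0) (h3 : ε (aU1 k) = 0)
    (h4 : ε (aU2 k) = 0) (M : Matrix (Fin 2) (Fin 2) k[X]) : ε (ofMatrix k M) = 0 := by
  simp [ofMatrix_apply, h1, h3, h4]

lemma PathA.exists_eq_ofMatrix_add {ε : PathA k →ₐ[k] k} (h1 : ε (aE1 k) = 0)
    (h2 : ε (aE2 k) = 1) (h3 : ε (aU1 k) = 0) (h4 : ε (aU2 k) = 0) (x : PathA k) :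
    ∃ M, x = ofMatrix k M + ε x • aE2 k := by
  obtain ⟨ρ, hρ1, hρ2, hρ3, hρ4⟩ := exists_matrixRep k
  have hmul := ofMatrix_mul hρ1 hρ2 hρ3 hρ4
  have hE2 : ∀ x, ∃ M, x * aE2 k = ofMatrix k M + ε x • aE2 k := fun x => by
    induction x using PathA.induction with
    | scalar c => exact ⟨0, by simp [Algebra.smul_def]⟩
    | e1 => exact ⟨0, by simp [h1, aE1_mul_aE2]⟩
    | e2 => exact ⟨0, by simp [h2, aE2_mul_aE2]⟩
    | u1 => exact ⟨0, by simp [h3, aU1_mul_aE2]⟩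
    | u2 => exact ⟨!![0, 1; 0, 0], by simp [h4, aU2_mul_aE2, ofMatrix_apply]⟩
    | add x y hx hy =>
      obtain ⟨M, hM⟩ := hx
      obtain ⟨M', hM'⟩ := hy
      refine ⟨M + M', ?_⟩
      rw [add_mul, hM, hM', map_add, map_add, add_smul]
      abel
    | mul x y hx hy =>
      obtain ⟨M, hM⟩ := hx
      obtain ⟨M', hM'⟩ := hy
      refine ⟨ρ x * M' + ε y • M, ?_⟩
      rw [mul_assoc, hM', mul_add, ← hmul, mul_smul_comm, hM, map_add, map_smul, map_mul ε,
        mul_comm (ε x), mul_smul, smul_add, add_assoc]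
  have hE1 : aE1 k = ofMatrix k !![1, 0; 0, 0] := by simp [ofMatrix_apply]
  obtain ⟨M, hM⟩ := hE2 x
  refine ⟨ρ x * !![1, 0; 0, 0] + M, ?_⟩
  rw [map_add, add_assoc, ← hM, hmul, ← hE1, ← mul_add, aE1_add_aE2, mul_one]

/-- The path algebra has the chain `0 ⊂ A e₁ A ⊂ A` of cell layers. -/
lemma PathA.hasCellChain {τ : PathA k →ₗ[k] PathA k} (hτ : IsKInvolution τ)
    (hτ1 : τ (aE1 k) = aE1 k) (hτ2 : τ (aE2 k) = aE2 k) (hτ3 : τ (aU1 k) = aU2 k)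
    (hτ4 : τ (aU2 k) = aU1 k) : HasCellChain τ := by
  obtain ⟨ρ, hρ1, hρ2, hρ3, hρ4⟩ := exists_matrixRep k
  obtain ⟨ε, hε1, hε2, hε3, hε4⟩ := exists_counit k
  have hmul := ofMatrix_mul hρ1 hρ2 hρ3 hρ4
  have hmap := map_ofMatrix hτ hτ1 hτ3 hτ4
  have hεM := counit_ofMatrix hε1 hε3 hε4
  have hdec := exists_eq_ofMatrix_add hε1 hε2 hε3 hε4
  obtain ⟨φ, hφ⟩ := (ofMatrix k).exists_leftInverse_of_injective
    (LinearMap.ker_eq_bot.2 ofMatrix_injective)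
  replace hφ : ∀ M, φ (ofMatrix k M) = M := fun M => LinearMap.congr_fun hφ M
  let lower : CellLayer τ ⊥ (LinearMap.range (ofMatrix k)) :=
    { ι := Fin 2
      B := k[X]
      rep := ρ
      coord := φ
      le := bot_le
      rep_eq_zero := fun x hx => by rw [(Submodule.mem_bot k).1 hx, map_zero]
      mul_mem := by
        rintro h _ ⟨M, rfl⟩
        exact ⟨_, hmul h M⟩
      map_mem := by
        rintro _ ⟨M, rfl⟩
        exact ⟨_, (hmap M).symm⟩
      coord_mul := by
        rintro h _ ⟨M, rfl⟩
        rw [← hmul, hφ, hφ]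
      coord_map := by
        rintro _ ⟨M, rfl⟩
        rw [hmap, hφ, hφ]
      coord_eq_zero := by
        rintro _ ⟨M, rfl⟩
        rw [hφ, Submodule.mem_bot, map_eq_zero_iff _ ofMatrix_injective]
      coord_surj := fun M => ⟨_, ⟨M, rfl⟩, hφ M⟩ }
  have hετ : ∀ x, ε (τ x) = ε x := fun x => by
    obtain ⟨M, hM⟩ := hdec x
    rw [hM, map_add τ, map_smul τ, hmap, hτ2]
    simp [hεM]
  have hker : ∀ x, ε x = 0 ↔ x ∈ LinearMap.range (ofMatrix k) := fun x => by
    refine ⟨fun hx => ?_, ?_⟩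
    · obtain ⟨M, hM⟩ := hdec x
      exact ⟨M, by rw [hM, hx, zero_smul, add_zero]⟩
    · rintro ⟨M, rfl⟩
      exact hεM M
  let upper : CellLayer τ (LinearMap.range (ofMatrix k)) ⊤ :=
    { ι := Unit
      B := k
      rep := (Matrix.scalarAlgHom Unit k).comp ε
      coord := ((Matrix.scalarAlgHom Unit k).comp ε).toLinearMap
      le := le_top
      rep_eq_zero := fun x hx => by rw [AlgHom.comp_apply, (hker x).2 hx, map_zero]
      mul_mem := fun _ _ _ => Submodule.mem_top
      map_mem := fun _ _ => Submodule.mem_top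
      coord_mul := fun h x _ => map_mul ((Matrix.scalarAlgHom Unit k).comp ε) h x
      coord_map := fun x _ => by simp [hετ]
      coord_eq_zero := fun x _ => by
        rw [← hker]
        exact map_eq_zero_iff (Matrix.scalar Unit) fun _ _ => Matrix.scalar_inj.1
      coord_surj := fun M => ⟨M () () • aE2 k, Submodule.mem_top, by ext; simp [hε2]⟩ }
  exact .tail (.single ⟨lower⟩) ⟨upper⟩

end PathAlgebra

section TensorPower

variable {k : Type} [Field k] {A : Type} [Ring A] [Algebra k A] {τ : A →ₗ[k] A}

lemma IsKInvolution.tauPow (hτ : IsKInvolution τ) : ∀ n, IsKInvolution (tauPow k A τ n)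
  | 0 => ⟨fun a b => mul_comm (G := k) a b, rfl, fun _ => rfl⟩
  | n + 1 => (hτ.tauPow n).tensor hτ

lemma HasCellChain.tauPow (hτ : HasCellChain τ) : ∀ n, HasCellChain (tauPow k A τ n)
  | 0 => hasCellChain_id
  | n + 1 => (hτ.tauPow n).tensor hτ

end TensorPower

/-- Corollary 2.25.  For every `m ∈ ℕ`, the `k`-algebra
`A^{⊗(m-1)} ⊗_k Ã` is affine cellular with respect to the involution `τ^{⊗m}`, where `τ`
fixes the vertex idempotents of each tensor factor and swaps the two arrows. -/
theorem pathAlgebra_tensorPower_affineCellular (k : Type) [Field k] (m : ℕ) :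
    ∃ τ : PathA k →ₗ[k] PathA k,
      IsKInvolution τ ∧
      τ (aE1 k) = aE1 k ∧ τ (aE2 k) = aE2 k ∧ τ (aU1 k) = aU2 k ∧ τ (aU2 k) = aU1 k ∧
      ∃ ω : (APow k (PathA k) (m - 1) ⊗[k] PathA k) →ₗ[k]
          (APow k (PathA k) (m - 1) ⊗[k] PathA k),
        (∀ (x : APow k (PathA k) (m - 1)) (a : PathA k),
          ω (x ⊗ₜ[k] a) = tauPow k (PathA k) τ (m - 1) x ⊗ₜ[k] τ a) ∧
        IsAffineCellular k (APow k (PathA k) (m - 1) ⊗[k] PathA k) ω := by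
  obtain ⟨τ, hτ, h1, h2, h3, h4⟩ := PathA.exists_involution k
  have hchain := PathA.hasCellChain hτ h1 h2 h3 h4
  exact ⟨τ, hτ, h1, h2, h3, h4, TensorProduct.map (tauPow k (PathA k) τ (m - 1)) τ,
    fun _ _ => rfl,
    ((hchain.tauPow _).tensor hchain).isAffineCellular ((hτ.tauPow _).tensor hτ)⟩

end VVPaper
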